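/- arXiv:2605.02514 — 2 statements merged into one kernel-verified Lean document; each statement's English description precedes it below -/
import Mathlib

section
/- The graphons W_{S¹}(x, y) = 1/2 + (1/8)·cos(d_{S¹}(x, y)) + (1/8)·cos(2·d_{S¹}(x, y)) on (S¹, uniform probability measure) and W_{S³}(x, y) = 1/2 + (1/4)·⟨x, y⟩ on (S³, uniform probability measure) are not weakly isomorphic: there exists a finite simple graph F such that t(F, W_{S¹}) ≠ t(F, W_{S³}). -/
open MeasureTheory
open scoped RealInnerProductSpace Classical

/-- The uniform (normalized surface) probability measure on the unit sphere of a Euclidean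
space. -/
noncomputable def sphereUniform (d : ℕ) :
    Measure (Metric.sphere (0 : EuclideanSpace ℝ (Fin d)) 1) :=
  (((volume : Measure (EuclideanSpace ℝ (Fin d))).toSphere Set.univ)⁻¹) •
    (volume : Measure (EuclideanSpace ℝ (Fin d))).toSphere

/-- The geodesic distance on the unit sphere: `d(x,y) = arccos ⟨x,y⟩`. -/
noncomputable def geodesic {d : ℕ} (x y : Metric.sphere (0 : EuclideanSpace ℝ (Fin d)) 1) :
    ℝ :=
  Real.arccos ⟪(x : EuclideanSpace ℝ (Fin d)), (y : EuclideanSpace ℝ (Fin d))⟫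

/-- The graphon `W_{S¹}(x,y) = 1/2 + (1/8)cos(d(x,y)) + (1/8)cos(2 d(x,y))` on the circle. -/
noncomputable def WS1 (x y : Metric.sphere (0 : EuclideanSpace ℝ (Fin 2)) 1) : ℝ :=
  1 / 2 + (1 / 8) * Real.cos (geodesic x y) + (1 / 8) * Real.cos (2 * geodesic x y)

/-- The graphon `W_{S³}(x,y) = 1/2 + (1/4)⟨x,y⟩` on the sphere `S³ ⊂ ℝ⁴`. -/
noncomputable def WS3 (x y : Metric.sphere (0 : EuclideanSpace ℝ (Fin 4)) 1) : ℝ :=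
  1 / 2 + (1 / 4) * ⟪(x : EuclideanSpace ℝ (Fin 4)), (y : EuclideanSpace ℝ (Fin 4))⟫

/-- The homomorphism density `t(F, W)` of a finite simple graph `F` (on vertex set `Fin m`)
in a kernel `W : Ω → Ω → ℝ` with respect to a measure `μ`. -/
noncomputable def homDensity {Ω : Type*} [MeasurableSpace Ω] (μ : Measure Ω)
    (W : Ω → Ω → ℝ) {m : ℕ} (G : SimpleGraph (Fin m)) : ℝ :=
  ∫ x : Fin m → Ω,
    ∏ p ∈ Finset.univ.filter (fun p : Fin m × Fin m => p.1 < p.2 ∧ G.Adj p.1 p.2),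
      W (x p.1) (x p.2) ∂(Measure.pi fun _ : Fin m => μ)


lemma diamond_integral_succ {Ω : Type*} [TopologicalSpace Ω] [CompactSpace Ω]
    [SecondCountableTopology Ω] [MeasurableSpace Ω] [BorelSpace Ω]
    (μ : Measure Ω) [IsProbabilityMeasure μ] (n : ℕ) (F : (Fin (n + 1) → Ω) → ℝ)
    (hF : Continuous F) :
    ∫ x, F x ∂(Measure.pi fun _ : Fin (n + 1) => μ) =
      ∫ a, ∫ x, F (Fin.cons a x) ∂(Measure.pi fun _ : Fin n => μ) ∂μ := by
  have h := (measurePreserving_piFinSuccAbove (fun _ : Fin (n + 1) => μ) 0).symm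
  rw [← h.integral_comp']
  simp_rw [MeasurableEquiv.piFinSuccAbove_symm_apply, Fin.insertNthEquiv,
    Fin.insertNth_zero, Equiv.coe_fn_mk]
  rw [integral_prod]
  · rfl
  · refine Continuous.integrable_of_hasCompactSupport ?_ (HasCompactSupport.of_compactSpace _)
    have : Continuous (fun p : Ω × (Fin n → Ω) => (Fin.cons p.1 p.2 : Fin (n+1) → Ω)) := by
      refine continuous_pi fun i => ?_
      refine Fin.cases ?_ (fun j => ?_) i
      · simpa using continuous_fst
      · simpa [Function.comp_def] using (continuous_apply j).comp continuous_snd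
    exact hF.comp this

def diamondG : SimpleGraph (Fin 4) where
  Adj a b := a ≠ b ∧ (a < 2 ∨ b < 2)
  symm := ⟨fun a b h => ⟨h.1.symm, h.2.symm⟩⟩
  loopless := ⟨fun a h => h.1 rfl⟩

lemma diamond_edges : Finset.univ.filter (fun p : Fin 4 × Fin 4 => p.1 < p.2 ∧ diamondG.Adj p.1 p.2)
    = {(0,1),(0,2),(0,3),(1,2),(1,3)} := by
  ext ⟨a, b⟩
  rw [Finset.mem_filter]
  change _ ∧ (a < b ∧ (a ≠ b ∧ (a < 2 ∨ b < 2))) ↔ _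
  simp only [Finset.mem_univ, true_and]
  fin_cases a <;> fin_cases b <;> simp

lemma diamond_iter {Ω : Type*} [TopologicalSpace Ω] [CompactSpace Ω]
    [SecondCountableTopology Ω] [MeasurableSpace Ω] [BorelSpace Ω]
    (μ : Measure Ω) [IsProbabilityMeasure μ] (W : Ω → Ω → ℝ)
    (hW : Continuous (fun p : Ω × Ω => W p.1 p.2)) :
    homDensity μ W diamondG =
      ∫ x, ∫ y, W x y * (∫ z, W x z * W y z ∂μ) ^ 2 ∂μ ∂μ := by
  unfold homDensity
  rw [diamond_edges]
  have e : ∀ x : Fin 4 → Ω, ∏ p ∈ ({(0,1),(0,2),(0,3),(1,2),(1,3)} : Finset (Fin 4 × Fin 4)),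
      W (x p.1) (x p.2) = W (x 0) (x 1) * ((W (x 0) (x 2) * W (x 1) (x 2)) *
        (W (x 0) (x 3) * W (x 1) (x 3))) := by
    intro x
    rw [Finset.prod_insert (by decide), Finset.prod_insert (by decide),
      Finset.prod_insert (by decide), Finset.prod_insert (by decide), Finset.prod_singleton]
    ring
  simp_rw [e]
  have c : ∀ {X : Type _} [TopologicalSpace X] {f g : X → Ω}, Continuous f → Continuous g →
      Continuous (fun t => W (f t) (g t)) := fun hf hg => hW.comp (hf.prodMk hg)
  have ap : ∀ i : Fin 4, Continuous (fun x : Fin 4 → Ω => x i) := fun i => continuous_apply i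
  rw [diamond_integral_succ]
  swap
  · exact (c (ap _) (ap _)).mul (((c (ap _) (ap _)).mul (c (ap _) (ap _))).mul
      ((c (ap _) (ap _)).mul (c (ap _) (ap _))))
  have k1 : ∀ (a : Ω) (x : Fin 3 → Ω), (Fin.cons a x : Fin 4 → Ω) 1 = x 0 := fun a x => rfl
  have k2 : ∀ (a : Ω) (x : Fin 3 → Ω), (Fin.cons a x : Fin 4 → Ω) 2 = x 1 := fun a x => rfl
  have k3 : ∀ (a : Ω) (x : Fin 3 → Ω), (Fin.cons a x : Fin 4 → Ω) 3 = x 2 := fun a x => rfl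
  simp_rw [k1, k2, k3, Fin.cons_zero]
  refine integral_congr_ae (Filter.Eventually.of_forall fun x0 => ?_)
  have ap3 : ∀ i : Fin 3, Continuous (fun x : Fin 3 → Ω => x i) := fun i => continuous_apply i
  have cc {X : Type _} [TopologicalSpace X] (a : Ω) : Continuous (fun _ : X => a) := continuous_const
  beta_reduce
  rw [diamond_integral_succ]
  swap
  · exact (c (cc _) (ap3 _)).mul (((c (cc _) (ap3 _)).mul (c (ap3 _) (ap3 _))).mul
      ((c (cc _) (ap3 _)).mul (c (ap3 _) (ap3 _))))
  have l1 : ∀ (a : Ω) (x : Fin 2 → Ω), (Fin.cons a x : Fin 3 → Ω) 1 = x 0 := fun a x => rfl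
  have l2 : ∀ (a : Ω) (x : Fin 2 → Ω), (Fin.cons a x : Fin 3 → Ω) 2 = x 1 := fun a x => rfl
  simp_rw [l1, l2, Fin.cons_zero]
  refine integral_congr_ae (Filter.Eventually.of_forall fun x1 => ?_)
  beta_reduce
  rw [integral_const_mul]
  congr 1
  have := integral_fintype_prod_eq_prod (ι := Fin 2) (fun _ z => W x0 z * W x1 z) (μ := fun _ => μ)
  simpa [Fin.prod_univ_two, sq] using this

lemma diamond_value {Ω : Type*} [TopologicalSpace Ω] [CompactSpace Ω]
    [SecondCountableTopology Ω] [MeasurableSpace Ω] [BorelSpace Ω]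
    (μ : Measure Ω) [IsProbabilityMeasure μ] (c κ : ℝ) (hc : c * κ = 1 / 16)
    (f : Fin 4 → Ω → ℝ) (hf : ∀ i, Continuous (f i)) (h0 : ∀ i, ∫ z, f i z ∂μ = 0)
    (h1 : ∀ i j, ∫ z, f i z * f j z ∂μ = if i = j then κ else 0)
    (W : Ω → Ω → ℝ) (hW : ∀ x y, W x y = 1 / 2 + c * ∑ i, f i x * f i y) :
    homDensity μ W diamondG = 1 / 32 + 17 / 512 * (1 / 64) +
      c ^ 3 / 256 * ∑ i, ∑ j, ∑ k, (∫ z, f i z * f j z * f k z ∂μ) ^ 2 := by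
  have int : ∀ g : Ω → ℝ, Continuous g → Integrable g μ := fun g hg =>
    hg.integrable_of_hasCompactSupport (HasCompactSupport.of_compactSpace _)
  rw [diamond_iter]
  swap
  · simp_rw [hW]; fun_prop
  have K1 : ∀ x, ∫ z, ∑ i, f i x * f i z ∂μ = 0 := by
    intro x
    rw [integral_finsetSum _ (fun i _ => int _ (by fun_prop))]
    simp [integral_const_mul, h0]
  have K2 : ∀ x y, ∫ z, (∑ i, f i x * f i z) * (∑ i, f i y * f i z) ∂μ
      = κ * ∑ i, f i x * f i y := by
    intro x y
    simp_rw [Finset.sum_mul_sum]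
    rw [integral_finsetSum _ (fun i _ => int _ (by fun_prop)), Finset.mul_sum]
    refine Finset.sum_congr rfl fun i _ => ?_
    rw [integral_finsetSum _ (fun i _ => int _ (by fun_prop))]
    have : ∀ j, ∫ z, f i x * f i z * (f j y * f j z) ∂μ = 
        (f i x * f j y) * if i = j then κ else 0 := by
      intro j
      rw [← h1, ← integral_const_mul]
      congr 1; ext z; ring
    simp [this]; ring
  have A : ∀ x y, ∫ z, W x z * W y z ∂μ = 1 / 4 + c / 16 * ∑ i, f i x * f i y := by
    intro x y
    have : ∀ z, W x z * W y z = 1 / 4 + (c / 2 * (∑ i, f i x * f i z)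
      + (c / 2 * (∑ i, f i y * f i z) 
      + c ^ 2 * ((∑ i, f i x * f i z) * (∑ i, f i y * f i z)))) := by
      intro z; rw [hW, hW]; ring
    simp_rw [this]
    rw [integral_add (int _ (by fun_prop)) (int _ (by fun_prop)),
      integral_add (int _ (by fun_prop)) (int _ (by fun_prop)),
      integral_add (int _ (by fun_prop)) (int _ (by fun_prop)),
      integral_const_mul, integral_const_mul, integral_const_mul, K1, K1, K2]
    simp
    linear_combination (c * ∑ i, f i x * f i y) * hc
  simp_rw [A]
  have B : ∀ x, ∫ y, W x y * (1 / 4 + c / 16 * ∑ i, f i x * f i y) ^ 2 ∂μ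
      = 1 / 32 + (17 / 512 * (c / 16) * (∑ i, f i x * f i x) 
        + c ^ 3 / 256 * ∑ i, ∑ j, ∑ k, f i x * f j x * f k x * ∫ z, f i z * f j z * f k z ∂μ) := by
    intro x
    have : ∀ y, W x y * (1 / 4 + c / 16 * ∑ i, f i x * f i y) ^ 2 = 1 / 32 +
      (5 / 64 * c * (∑ i, f i x * f i y) 
      + (17 / 512 * c ^ 2 * ((∑ i, f i x * f i y) * (∑ i, f i x * f i y))
      + c ^ 3 / 256 * ∑ i, ∑ j, ∑ k, f i x * f j x * f k x * (f i y * f j y * f k y))) := by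
      intro y
      have : ∑ i, ∑ j, ∑ k, f i x * f j x * f k x * (f i y * f j y * f k y)
        = (∑ i, f i x * f i y) * ((∑ i, f i x * f i y) * (∑ i, f i x * f i y)) := by
        simp_rw [Finset.sum_mul_sum, Finset.mul_sum]
        refine Finset.sum_congr rfl fun i _ => Finset.sum_congr rfl fun j _ => 
          Finset.sum_congr rfl fun k _ => by ring
      rw [this, hW]; ring
    simp_rw [this]
    rw [integral_add (int _ (by fun_prop)) (int _ (by fun_prop)),
      integral_add (int _ (by fun_prop)) (int _ (by fun_prop)),
      integral_add (int _ (by fun_prop)) (int _ (by fun_prop)),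
      integral_const_mul, integral_const_mul, integral_const_mul, K1, K2,
      integral_finsetSum _ (fun i _ => int _ (by fun_prop))]
    simp_rw [fun i => integral_finsetSum (μ := μ) Finset.univ (fun (j : Fin 4) _ => int 
      (fun y => ∑ k, f i x * f j x * f k x * (f i y * f j y * f k y)) (by fun_prop)),
      fun i j => integral_finsetSum (μ := μ) Finset.univ (fun (k : Fin 4) _ => int 
      (fun y => f i x * f j x * f k x * (f i y * f j y * f k y)) (by fun_prop)),
      integral_const_mul]
    simp
    linear_combination (17 / 512 * c * ∑ i, f i x * f i x) * hc
  simp_rw [B]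
  rw [integral_add (int _ (by fun_prop)) (int _ (by fun_prop)),
      integral_add (int _ (by fun_prop)) (int _ (by fun_prop)),
      integral_const_mul, integral_const_mul, 
      integral_finsetSum _ (fun i _ => int _ (by fun_prop)),
      integral_finsetSum _ (fun i _ => int _ (by fun_prop))]
  simp_rw [fun i => integral_finsetSum (μ := μ) Finset.univ (fun (j : Fin 4) _ => int 
      (fun x => ∑ k, f i x * f j x * f k x * ∫ z, f i z * f j z * f k z ∂μ) (by fun_prop)),
      fun i j => integral_finsetSum (μ := μ) Finset.univ (fun (k : Fin 4) _ => int 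
      (fun x => f i x * f j x * f k x * ∫ z, f i z * f j z * f k z ∂μ) (by fun_prop)),
      integral_mul_const, h1, ← sq]
  simp
  linear_combination (17 / 512 / 4) * hc

lemma sphereU_prob (d : ℕ) [NeZero d] : IsProbabilityMeasure (sphereUniform d) := by
  constructor
  have : Nontrivial (EuclideanSpace ℝ (Fin d)) := inferInstance
  unfold sphereUniform
  rw [Measure.smul_apply, smul_eq_mul]
  refine ENNReal.inv_mul_cancel ?_ (measure_ne_top _ _)
  rw [Ne, Measure.measure_univ_eq_zero]
  exact Measure.toSphere_ne_zero _

lemma sphereU_inv (d : ℕ) (L : EuclideanSpace ℝ (Fin d) ≃ₗᵢ[ℝ] EuclideanSpace ℝ (Fin d))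
    (g : EuclideanSpace ℝ (Fin d) → ℝ) :
    ∫ z, g (L (z : EuclideanSpace ℝ (Fin d))) ∂(sphereUniform d) = 
      ∫ z, g (z : EuclideanSpace ℝ (Fin d)) ∂(sphereUniform d) := by
  let S := Metric.sphere (0 : EuclideanSpace ℝ (Fin d)) 1
  let φ : S ≃ₜ S :=
    { toFun := fun z => ⟨L z, by simpa [S] using norm_eq_of_mem_sphere z⟩
      invFun := fun z => ⟨L.symm z, by simpa [S] using norm_eq_of_mem_sphere z⟩
      left_inv := fun z => by simp
      right_inv := fun z => by simp
      continuous_toFun := by fun_prop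
      continuous_invFun := by fun_prop }
  have hφ : MeasurePreserving φ (sphereUniform d) (sphereUniform d) := by
    unfold sphereUniform
    apply MeasurePreserving.smul_measure
    refine ⟨φ.continuous.measurable, ?_⟩
    ext s hs
    rw [Measure.map_apply φ.continuous.measurable hs, Measure.toSphere_apply' _ hs,
      Measure.toSphere_apply' _ (φ.continuous.measurable hs)]
    congr 1
    refine Eq.trans ?_ (MeasurePreserving.measure_preimage_equiv (f := L.toMeasurableEquiv)
      L.measurePreserving _)
    congr 1
    ext v
    simp only [Set.mem_smul, Set.mem_image, Set.mem_preimage]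
    constructor
    · rintro ⟨r, hr, _, ⟨z, hz, rfl⟩, rfl⟩
      exact ⟨r, hr, _, ⟨φ z, hz, rfl⟩, by simp [φ]⟩
    · rintro ⟨r, hr, _, ⟨z, hz, rfl⟩, h⟩
      refine ⟨r, hr, _, ⟨φ.symm z, by simpa using hz, rfl⟩, ?_⟩
      apply L.injective
      simpa [φ] using h
  exact hφ.integral_comp φ.measurableEmbedding (fun z : S => g z)

noncomputable def refl2 (a b : ℝ) (h : a ^ 2 + b ^ 2 = 1) :
    EuclideanSpace ℝ (Fin 2) ≃ₗᵢ[ℝ] EuclideanSpace ℝ (Fin 2) :=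
  LinearIsometry.toLinearIsometryEquiv
    { toFun := fun v => !₂[a * v 0 + b * v 1, b * v 0 - a * v 1]
      map_add' := fun v w => by ext i; fin_cases i <;> simp <;> ring
      map_smul' := fun r v => by ext i; fin_cases i <;> simp <;> ring
      norm_map' := fun v => by
        simp only [EuclideanSpace.norm_eq, LinearMap.coe_mk, AddHom.coe_mk, Fin.sum_univ_two]
        congr 1
        simp
        linear_combination (v 0 ^ 2 + v 1 ^ 2) * h } rfl

lemma refl2_zero (a b : ℝ) (h : a ^ 2 + b ^ 2 = 1) (v : EuclideanSpace ℝ (Fin 2)) :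
    refl2 a b h v 0 = a * v 0 + b * v 1 := by simp [refl2]

lemma refl2_one (a b : ℝ) (h : a ^ 2 + b ^ 2 = 1) (v : EuclideanSpace ℝ (Fin 2)) :
    refl2 a b h v 1 = b * v 0 - a * v 1 := by simp [refl2]

abbrev S1 := Metric.sphere (0 : EuclideanSpace ℝ (Fin 2)) 1
abbrev S3 := Metric.sphere (0 : EuclideanSpace ℝ (Fin 4)) 1

lemma S1_inv (a b : ℝ) (h : a ^ 2 + b ^ 2 = 1) (g : ℝ → ℝ → ℝ) :
    ∫ z : S1, g (a * z.1 0 + b * z.1 1) (b * z.1 0 - a * z.1 1) ∂(sphereUniform 2) = 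
      ∫ z : S1, g (z.1 0) (z.1 1) ∂(sphereUniform 2) := by
  have := sphereU_inv 2 (refl2 a b h) (fun v => g (v 0) (v 1))
  simpa only [refl2_zero, refl2_one] using this

lemma S1_flip (g : ℝ → ℝ → ℝ) :
    ∫ z : S1, g (z.1 0) (-z.1 1) ∂(sphereUniform 2) = 
      ∫ z : S1, g (z.1 0) (z.1 1) ∂(sphereUniform 2) := by
  simpa using S1_inv 1 0 (by norm_num) g

lemma S1_swap (g : ℝ → ℝ → ℝ) :
    ∫ z : S1, g (z.1 1) (z.1 0) ∂(sphereUniform 2) = 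
      ∫ z : S1, g (z.1 0) (z.1 1) ∂(sphereUniform 2) := by
  simpa using S1_inv 0 1 (by norm_num) g

lemma S1_sq (z : S1) : z.1 0 ^ 2 + z.1 1 ^ 2 = 1 := by
  have h : ‖z.1‖ = 1 := by simp
  have := EuclideanSpace.real_norm_sq_eq z.1
  rw [h] at this
  simpa [Fin.sum_univ_two] using this.symm

lemma S1_odd1 (g : ℝ → ℝ → ℝ) (hg : ∀ p q, g p (-q) = - g p q) :
    ∫ z : S1, g (z.1 0) (z.1 1) ∂(sphereUniform 2) = 0 := by
  have := S1_flip g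
  simp_rw [hg, integral_neg] at this
  linarith

lemma S1_odd0 (g : ℝ → ℝ → ℝ) (hg : ∀ p q, g (-p) q = - g p q) :
    ∫ z : S1, g (z.1 0) (z.1 1) ∂(sphereUniform 2) = 0 := by
  have := S1_odd1 (fun p q => g q p) (fun p q => hg q p)
  rw [← S1_swap]; exact this

lemma S1_alt (g : ℝ → ℝ → ℝ) (hg : ∀ p q, g q p = - g p q) :
    ∫ z : S1, g (z.1 0) (z.1 1) ∂(sphereUniform 2) = 0 := by
  have := S1_swap g
  have e : ∀ z : S1, g (z.1 1) (z.1 0) = - g (z.1 0) (z.1 1) := fun z => hg _ _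
  simp_rw [e, integral_neg] at this
  linarith

lemma S_int {d : ℕ} [NeZero d] (g : Metric.sphere (0 : EuclideanSpace ℝ (Fin d)) 1 → ℝ)
    (hg : Continuous g) : Integrable g (sphereUniform d) := by
  have := sphereU_prob d
  exact hg.integrable_of_hasCompactSupport (HasCompactSupport.of_compactSpace _)

/-- the features on the circle -/
noncomputable def f1 : Fin 4 → S1 → ℝ :=
  ![fun z => z.1 0, fun z => z.1 1, fun z => z.1 0 ^ 2 - z.1 1 ^ 2, fun z => 2 * z.1 0 * z.1 1]

lemma S1_p2 : ∫ z : S1, z.1 0 * z.1 0 ∂(sphereUniform 2) = 1 / 2 := by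
  have := sphereU_prob 2
  have h := S1_swap (fun p _ => p * p)
  have h2 : ∫ z : S1, (z.1 0 * z.1 0 + z.1 1 * z.1 1) ∂(sphereUniform 2) = 1 := by
    have : ∀ z : S1, z.1 0 * z.1 0 + z.1 1 * z.1 1 = 1 := fun z => by
      have := S1_sq z; linarith
    simp_rw [this]; simp
  rw [integral_add (S_int _ (by fun_prop)) (S_int _ (by fun_prop))] at h2
  beta_reduce at h
  linarith

lemma S1_q2 : ∫ z : S1, z.1 1 * z.1 1 ∂(sphereUniform 2) = 1 / 2 := by
  rw [← S1_p2]; exact S1_swap (fun p _ => p * p)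

lemma S1_rot : ∫ z : S1, (2 * z.1 0 * z.1 1) * (2 * z.1 0 * z.1 1) ∂(sphereUniform 2) = 
    ∫ z : S1, (z.1 0 ^ 2 - z.1 1 ^ 2) * (z.1 0 ^ 2 - z.1 1 ^ 2) ∂(sphereUniform 2) := by
  have hs : (√2)⁻¹ ^ 2 = (1 / 2 : ℝ) := by rw [inv_pow, Real.sq_sqrt (by norm_num)]; norm_num
  have := S1_inv (√2)⁻¹ (√2)⁻¹ (by rw [hs]; norm_num) (fun p q => (p ^ 2 - q ^ 2) * (p ^ 2 - q ^ 2))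
  rw [← this]
  congr 1; ext z
  have : ((√2)⁻¹ * z.1 0 + (√2)⁻¹ * z.1 1) ^ 2 - ((√2)⁻¹ * z.1 0 - (√2)⁻¹ * z.1 1) ^ 2
    = 2 * z.1 0 * z.1 1 := by linear_combination 4 * z.1 0 * z.1 1 * hs
  rw [this]

lemma S1_C2 : ∫ z : S1, (z.1 0 ^ 2 - z.1 1 ^ 2) * (z.1 0 ^ 2 - z.1 1 ^ 2) ∂(sphereUniform 2)
    = 1 / 2 := by
  have := sphereU_prob 2
  have h := S1_rot
  have h2 : ∫ z : S1, ((2 * z.1 0 * z.1 1) * (2 * z.1 0 * z.1 1) +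
      (z.1 0 ^ 2 - z.1 1 ^ 2) * (z.1 0 ^ 2 - z.1 1 ^ 2)) ∂(sphereUniform 2) = 1 := by
    have : ∀ z : S1, ((2 * z.1 0 * z.1 1) * (2 * z.1 0 * z.1 1) +
      (z.1 0 ^ 2 - z.1 1 ^ 2) * (z.1 0 ^ 2 - z.1 1 ^ 2)) = 1 := fun z => by
      have := S1_sq z
      linear_combination (z.1 0 ^ 2 + z.1 1 ^ 2 + 1) * this
    simp_rw [this]; simp
  rw [integral_add (S_int _ (by fun_prop)) (S_int _ (by fun_prop))] at h2
  linarith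

lemma f1_h0 (i : Fin 4) : ∫ z, f1 i z ∂(sphereUniform 2) = 0 := by
  fin_cases i
  · exact S1_odd0 (fun p _ => p) (by intros; ring)
  · exact S1_odd1 (fun _ q => q) (by intros; ring)
  · exact S1_alt (fun p q => p ^ 2 - q ^ 2) (by intros; ring)
  · exact S1_odd1 (fun p q => 2 * p * q) (by intros; ring)

lemma f1_h1 (i j : Fin 4) : ∫ z, f1 i z * f1 j z ∂(sphereUniform 2) = 
    if i = j then 1 / 2 else 0 := by
  fin_cases i <;> fin_cases j
  · exact S1_p2
  · exact S1_odd0 (fun p q => p * q) (by intros; ring)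
  · exact S1_odd0 (fun p q => p * (p ^ 2 - q ^ 2)) (by intros; ring)
  · exact S1_odd1 (fun p q => p * (2 * p * q)) (by intros; ring)
  · exact S1_odd0 (fun p q => q * p) (by intros; ring)
  · exact S1_q2
  · exact S1_odd1 (fun p q => q * (p ^ 2 - q ^ 2)) (by intros; ring)
  · exact S1_odd0 (fun p q => q * (2 * p * q)) (by intros; ring)
  · exact S1_odd0 (fun p q => (p ^ 2 - q ^ 2) * p) (by intros; ring)
  · exact S1_odd1 (fun p q => (p ^ 2 - q ^ 2) * q) (by intros; ring)
  · exact S1_C2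
  · exact S1_odd1 (fun p q => (p ^ 2 - q ^ 2) * (2 * p * q)) (by intros; ring)
  · exact S1_odd1 (fun p q => (2 * p * q) * p) (by intros; ring)
  · exact S1_odd0 (fun p q => (2 * p * q) * q) (by intros; ring)
  · exact S1_odd1 (fun p q => (2 * p * q) * (p ^ 2 - q ^ 2)) (by intros; ring)
  · exact S1_rot.trans S1_C2

lemma f1_h2 : ∫ z, f1 0 z * f1 0 z * f1 2 z ∂(sphereUniform 2) = 1 / 4 := by
  have e : ∀ z : S1, f1 0 z * f1 0 z * f1 2 z = 1 / 2 * (z.1 0 ^ 2 - z.1 1 ^ 2) 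
    + 1 / 2 * ((z.1 0 ^ 2 - z.1 1 ^ 2) * (z.1 0 ^ 2 - z.1 1 ^ 2)) := by
    intro z
    change z.1 0 * z.1 0 * (z.1 0 ^ 2 - z.1 1 ^ 2) = _
    linear_combination (1 / 2 * (z.1 0 ^ 2 - z.1 1 ^ 2)) * S1_sq z
  simp_rw [e]
  rw [integral_add (S_int _ (by fun_prop)) (S_int _ (by fun_prop)), integral_const_mul,
    integral_const_mul, S1_C2]
  have : ∫ z : S1, (z.1 0 ^ 2 - z.1 1 ^ 2) ∂(sphereUniform 2) = 0 := f1_h0 2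
  rw [this]; norm_num

lemma f1_cont (i : Fin 4) : Continuous (f1 i) := by
  fin_cases i <;> simp only [f1] <;> simp <;> fun_prop

lemma WS1_eq (x y : S1) : WS1 x y = 1 / 2 + 1 / 8 * ∑ i, f1 i x * f1 i y := by
  have hx : ‖x.1‖ = 1 := by simp
  have hy : ‖y.1‖ = 1 := by simp
  have h := abs_real_inner_le_norm x.1 y.1
  rw [hx, hy, mul_one] at h
  unfold WS1 geodesic
  rw [Real.cos_two_mul, Real.cos_arccos (neg_le_of_abs_le h) (le_of_abs_le h)]
  have hin : ⟪x.1, y.1⟫ = x.1 0 * y.1 0 + x.1 1 * y.1 1 := by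
    simp [PiLp.inner_apply, Fin.sum_univ_two]; ring
  rw [hin, Fin.sum_univ_four]
  change _ = 1 / 2 + 1 / 8 * (x.1 0 * y.1 0 + x.1 1 * y.1 1 + 
    (x.1 0 ^ 2 - x.1 1 ^ 2) * (y.1 0 ^ 2 - y.1 1 ^ 2) + 2 * x.1 0 * x.1 1 * (2 * y.1 0 * y.1 1))
  linear_combination (1/8 * (y.1 0 ^ 2 + y.1 1 ^ 2)) * S1_sq x + 1 / 8 * S1_sq y

/-- the features on the three-sphere -/
noncomputable def f3 : Fin 4 → S3 → ℝ := fun i z => z.1 i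

lemma f3_h0 (i : Fin 4) : ∫ z, f3 i z ∂(sphereUniform 4) = 0 := by
  have := sphereU_inv 4 (LinearIsometryEquiv.neg ℝ) (fun v => v i)
  simp [integral_neg] at this
  simp only [f3]
  linarith

lemma f3_h2 (i j k : Fin 4) : ∫ z, f3 i z * f3 j z * f3 k z ∂(sphereUniform 4) = 0 := by
  have := sphereU_inv 4 (LinearIsometryEquiv.neg ℝ) (fun v => v i * v j * v k)
  simp [integral_neg] at this
  simp only [f3]
  linarith

noncomputable def flipAt (i : Fin 4) :
    EuclideanSpace ℝ (Fin 4) ≃ₗᵢ[ℝ] EuclideanSpace ℝ (Fin 4) :=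
  LinearIsometryEquiv.piLpCongrRight 2
    (fun j => if j = i then LinearIsometryEquiv.neg ℝ else LinearIsometryEquiv.refl ℝ ℝ)

lemma f3_h1 (i j : Fin 4) : ∫ z, f3 i z * f3 j z ∂(sphereUniform 4) = 
    if i = j then 1 / 4 else 0 := by
  have := sphereU_prob 4
  simp only [f3]
  split_ifs with hij
  · subst hij
    have hs : ∀ k : Fin 4, ∫ z : S3, z.1 k * z.1 k ∂(sphereUniform 4) = 
        ∫ z : S3, z.1 i * z.1 i ∂(sphereUniform 4) := by
      intro k
      have := sphereU_inv 4 (LinearIsometryEquiv.piLpCongrLeft 2 ℝ ℝ (Equiv.swap i k)) 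
        (fun v => v i * v i)
      simpa [LinearIsometryEquiv.piLpCongrLeft_apply, Equiv.piCongrLeft'] using this
    have h2 : ∫ z : S3, ∑ k, z.1 k * z.1 k ∂(sphereUniform 4) = 1 := by
      have : ∀ z : S3, ∑ k, z.1 k * z.1 k = 1 := fun z => by
        have h : ‖z.1‖ = 1 := by simp
        have := EuclideanSpace.real_norm_sq_eq z.1
        rw [h] at this
        simpa [sq] using this.symm
      simp_rw [this]; simp
    rw [integral_finsetSum _ (fun i _ => S_int _ (by fun_prop))] at h2
    simp_rw [hs] at h2
    simp at h2
    linarith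
  · have := sphereU_inv 4 (flipAt i) (fun v => v i * v j)
    simp [flipAt, Ne.symm hij, integral_neg] at this
    linarith

/-- the graphons `W_{S¹}` and `W_{S³}` are not weakly isomorphic: some
finite simple graph has different homomorphism densities in the two graphons. -/
theorem WS1_WS3_not_weaklyIsomorphic :
    ∃ (m : ℕ) (G : SimpleGraph (Fin m)),
      homDensity (sphereUniform 2) WS1 G ≠ homDensity (sphereUniform 4) WS3 G := by
  have := sphereU_prob 2
  have := sphereU_prob 4
  refine ⟨4, diamondG, ?_⟩
  rw [diamond_value (sphereUniform 2) (1 / 8) (1 / 2) (by norm_num) f1 f1_cont f1_h0 f1_h1 WS1 WS1_eq,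
    diamond_value (sphereUniform 4) (1 / 4) (1 / 4) (by norm_num) f3 
      (fun i => by unfold f3; fun_prop) f3_h0 f3_h1 WS3
      (fun x y => by simp [WS3, f3, PiLp.inner_apply, mul_comm])]
  simp_rw [f3_h2]
  have pos : 0 < ∑ i, ∑ j, ∑ k, (∫ z, f1 i z * f1 j z * f1 k z ∂(sphereUniform 2)) ^ 2 := by
    refine Finset.sum_pos' (fun i _ => by positivity) ⟨0, Finset.mem_univ _, ?_⟩
    refine Finset.sum_pos' (fun i _ => by positivity) ⟨0, Finset.mem_univ _, ?_⟩
    refine Finset.sum_pos' (fun i _ => by positivity) ⟨2, Finset.mem_univ _, ?_⟩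
    rw [f1_h2]; norm_num
  simp only [ne_eq, OfNat.ofNat_ne_zero, not_false_eq_true, zero_pow, Finset.sum_const_zero, mul_zero, add_zero]
  intro h
  nlinarith
end

section
/- Let W be a graphon on a probability space (Ω, 𝒜, μ), let (e_i)_{i ∈ I} be an orthonormal Hilbert basis of L²(Ω, μ), and let λ : I → ℝ be such that T_W e_i = λ_i e_i for every i ∈ I. Then for every k ≥ 3, the homomorphism density of the k-cycle C_k in W equals the k-th power sum of the eigenvalues: t(C_k, W) = ∫_{Ω^k} W(x₁,x₂) W(x₂,x₃) ⋯ W(x_k, x₁) dμ(x₁)⋯dμ(x_k) = Σ_{i ∈ I} λ_i^k. In particular, cycle homomorphism densities are spectrally invariant: isospectral graphons have equal cycle densities. -/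
open MeasureTheory

namespace CycleAux

variable {Ω : Type*} [MeasurableSpace Ω] {μ : Measure Ω} [IsProbabilityMeasure μ]

lemma tens_memLp (f h : Lp ℝ 2 μ) :
    MemLp (fun p : Ω × Ω => f p.1 * h p.2) 2 (μ.prod μ) := by
  have hf := Lp.memLp f
  have hh := Lp.memLp h
  have hm : AEStronglyMeasurable (fun p : Ω × Ω => f p.1 * h p.2) (μ.prod μ) :=
    hf.1.comp_fst.mul hh.1.comp_snd
  rw [memLp_two_iff_integrable_sq hm]
  have := hf.integrable_sq.mul_prod hh.integrable_sq
  simpa [mul_pow] using this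

noncomputable def tens (f h : Lp ℝ 2 μ) : Lp ℝ 2 (μ.prod μ) := (tens_memLp f h).toLp _

lemma tens_coe (f h : Lp ℝ 2 μ) :
    (tens f h : Ω × Ω → ℝ) =ᵐ[μ.prod μ] fun p => f p.1 * h p.2 := (tens_memLp f h).coeFn_toLp

lemma inner_tens (f h f' h' : Lp ℝ 2 μ) :
    inner ℝ (tens f h) (tens f' h') = inner ℝ f f' * inner ℝ h h' := by
  simp only [L2.inner_def]
  rw [← integral_prod_mul]
  apply integral_congr_ae
  filter_upwards [tens_coe f h, tens_coe f' h'] with p h1 h2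
  simp only [h1, h2, RCLike.inner_apply, conj_trivial]
  ring

lemma norm_tens (f h : Lp ℝ 2 μ) : ‖tens f h‖ = ‖f‖ * ‖h‖ := by
  have := inner_tens f h f h
  simp only [real_inner_self_eq_norm_sq] at this
  rw [← mul_pow] at this
  exact (sq_eq_sq₀ (norm_nonneg _) (by positivity)).1 this

noncomputable def tensL (h : Lp ℝ 2 μ) : Lp ℝ 2 μ →ₗ[ℝ] Lp ℝ 2 (μ.prod μ) where
  toFun f := tens f h
  map_add' f g := by
    apply Lp.ext
    have h1 := Measure.quasiMeasurePreserving_fst (μ := μ) (ν := μ) |>.ae (Lp.coeFn_add f g)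
    filter_upwards [tens_coe (f + g) h, tens_coe f h, tens_coe g h,
      Lp.coeFn_add (tens f h) (tens g h), h1] with p a b c d e
    simp only [a, d, Pi.add_apply, b, c, e]; ring
  map_smul' r f := by
    apply Lp.ext
    have h1 := Measure.quasiMeasurePreserving_fst (μ := μ) (ν := μ) |>.ae (Lp.coeFn_smul r f)
    filter_upwards [tens_coe (r • f) h, tens_coe f h,
      Lp.coeFn_smul r (tens f h), h1] with p a b d e
    simp only [a, d, Pi.smul_apply, b, e, RingHom.id_apply, smul_eq_mul]; ring

noncomputable def tensR (h : Lp ℝ 2 μ) : Lp ℝ 2 μ →ₗ[ℝ] Lp ℝ 2 (μ.prod μ) where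
  toFun f := tens h f
  map_add' f g := by
    apply Lp.ext
    have h1 := Measure.quasiMeasurePreserving_snd (μ := μ) (ν := μ) |>.ae (Lp.coeFn_add f g)
    filter_upwards [tens_coe h (f + g), tens_coe h f, tens_coe h g,
      Lp.coeFn_add (tens h f) (tens h g), h1] with p a b c d e
    simp only [a, d, Pi.add_apply, b, c, e]; ring
  map_smul' r f := by
    apply Lp.ext
    have h1 := Measure.quasiMeasurePreserving_snd (μ := μ) (ν := μ) |>.ae (Lp.coeFn_smul r f)
    filter_upwards [tens_coe h (r • f), tens_coe h f,
      Lp.coeFn_smul r (tens h f), h1] with p a b d e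
    simp only [a, d, Pi.smul_apply, b, e, RingHom.id_apply, smul_eq_mul]; ring

lemma inner_zero_of_basis {ι : Type*} (e : HilbertBasis ι ℝ (Lp ℝ 2 μ))
    (T : Lp ℝ 2 μ →ₗ[ℝ] Lp ℝ 2 (μ.prod μ)) (C : ℝ) (hT : ∀ f, ‖T f‖ ≤ C * ‖f‖)
    (g : Lp ℝ 2 (μ.prod μ)) (h0 : ∀ i, inner ℝ g (T (e i)) = 0) (f : Lp ℝ 2 μ) :
    inner ℝ g (T f) = 0 := by
  let L : Lp ℝ 2 μ →L[ℝ] ℝ := (innerSL ℝ g).comp (T.mkContinuous C hT)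
  have : L = 0 := by
    apply ContinuousLinearMap.ext_on (s := Set.range e)
    · have := e.dense_span
      rw [Submodule.dense_iff_topologicalClosure_eq_top]; exact this
    · rintro _ ⟨i, rfl⟩
      exact h0 i
  exact congrArg (fun M : Lp ℝ 2 μ →L[ℝ] ℝ => M f) this

lemma eq_zero_of_rect (g : Lp ℝ 2 (μ.prod μ))
    (h : ∀ f k : Lp ℝ 2 μ, inner ℝ g (tens f k) = 0) : g = 0 := by
  have hgi : Integrable g (μ.prod μ) := (Lp.memLp g).integrable (by norm_num)
  have hrect : ∀ A B : Set Ω, MeasurableSet A → MeasurableSet B →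
      ∫ p in A ×ˢ B, g p ∂(μ.prod μ) = 0 := by
    intro A B hA hB
    have := h (indicatorConstLp 2 hA (measure_ne_top _ _) 1)
      (indicatorConstLp 2 hB (measure_ne_top _ _) 1)
    rw [← this, L2.inner_def, ← integral_indicator (hA.prod hB)]
    apply integral_congr_ae
    have h1 := Measure.quasiMeasurePreserving_fst (μ := μ) (ν := μ) |>.ae
      (indicatorConstLp_coeFn (p := 2) (hs := hA) (hμs := measure_ne_top μ A) (c := (1:ℝ)))
    have h2 := Measure.quasiMeasurePreserving_snd (μ := μ) (ν := μ) |>.ae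
      (indicatorConstLp_coeFn (p := 2) (hs := hB) (hμs := measure_ne_top μ B) (c := (1:ℝ)))
    filter_upwards [tens_coe (indicatorConstLp 2 hA (measure_ne_top μ A) (1:ℝ))
      (indicatorConstLp 2 hB (measure_ne_top μ B) (1:ℝ)), h1, h2] with p a b c
    simp only [RCLike.inner_apply, conj_trivial, a, b, c]
    by_cases hp : p.1 ∈ A <;> by_cases hq : p.2 ∈ B <;> simp [Set.indicator, hp, hq]
  have hall : ∀ s : Set (Ω × Ω), MeasurableSet s → ∫ p in s, g p ∂(μ.prod μ) = 0 := by
    intro s hs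
    induction s, hs using MeasurableSpace.induction_on_inter
      generateFrom_prod.symm isPiSystem_prod with
    | empty => simp
    | basic t ht =>
      obtain ⟨A, hA, B, hB, rfl⟩ := ht
      exact hrect A B hA hB
    | compl t ht ih =>
      have h1 := integral_add_compl ht hgi
      have h2 := hrect Set.univ Set.univ .univ .univ
      simp only [Set.univ_prod_univ, setIntegral_univ] at h2
      rw [ih, h2, zero_add] at h1
      exact h1
    | iUnion f hd hm ih =>
      rw [integral_iUnion hm hd hgi.integrableOn]
      simp [ih]
  have := hgi.ae_eq_zero_of_forall_setIntegral_eq_zero (fun s hs _ => hall s hs)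
  exact (Lp.eq_zero_iff_ae_eq_zero).2 this

lemma tens_basis {ι : Type*} (e : HilbertBasis ι ℝ (Lp ℝ 2 μ)) :
    ∃ b : HilbertBasis (ι × ι) ℝ (Lp ℝ 2 (μ.prod μ)), ∀ p, b p = tens (e p.1) (e p.2) := by
  classical
  have ho : Orthonormal ℝ (fun p : ι × ι => tens (e p.1) (e p.2)) := by
    rw [orthonormal_iff_ite]
    rintro ⟨i, j⟩ ⟨i', j'⟩
    have := orthonormal_iff_ite.1 e.orthonormal
    simp only [inner_tens, this, Prod.mk.injEq]
    by_cases h1 : i = i' <;> by_cases h2 : j = j' <;> simp [h1, h2]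
  refine ⟨HilbertBasis.mkOfOrthogonalEqBot ho ?_, fun p => congrFun (HilbertBasis.coe_mkOfOrthogonalEqBot ho _) p⟩
  rw [Submodule.eq_bot_iff]
  intro g hg
  apply eq_zero_of_rect
  intro f k
  refine inner_zero_of_basis e (tensL k) ‖k‖
    (fun f => by rw [mul_comm]; exact (norm_tens f k).le) g (fun i => ?_) f
  refine inner_zero_of_basis e (tensR (e i)) ‖e i‖
    (fun f => (norm_tens (e i) f).le) g (fun j => ?_) k
  exact (Submodule.mem_orthogonal' _ _).1 hg _ (Submodule.subset_span ⟨(i, j), rfl⟩)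

/-- iterated kernels -/
noncomputable def ker (μ : Measure Ω) (W : Ω → Ω → ℝ) : ℕ → Ω → Ω → ℝ
  | 0 => W
  | n + 1 => fun x y => ∫ z, W x z * ker μ W n z y ∂μ

lemma ker_meas {W : Ω → Ω → ℝ} (hW : Measurable (Function.uncurry W)) (n : ℕ) :
    Measurable (Function.uncurry (ker μ W n)) := by
  induction n with
  | zero => exact hW
  | succ n ih =>
    have : StronglyMeasurable (fun q : (Ω × Ω) × Ω => W q.1.1 q.2 * ker μ W n q.2 q.1.2) := by
      apply Measurable.stronglyMeasurable
      have a : Measurable (fun q : (Ω × Ω) × Ω => W q.1.1 q.2) :=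
        hW.comp (g := Function.uncurry W) (f := fun q : (Ω × Ω) × Ω => (q.1.1, q.2)) (by fun_prop)
      have b : Measurable (fun q : (Ω × Ω) × Ω => ker μ W n q.2 q.1.2) :=
        ih.comp (f := fun q : (Ω × Ω) × Ω => (q.2, q.1.2)) (by fun_prop)
      exact a.mul b
    exact (this.integral_prod_right' (ν := μ)).measurable

lemma ker_bound {W : Ω → Ω → ℝ} (hW : ∀ x y, W x y ∈ Set.Icc (0 : ℝ) 1) (n : ℕ) (x y : Ω) :
    |ker μ W n x y| ≤ 1 := by
  induction n generalizing x y with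
  | zero => exact abs_le.2 ⟨by linarith [(hW x y).1, show ker μ W 0 x y = W x y from rfl], (hW x y).2⟩
  | succ n ih =>
    have := norm_integral_le_of_norm_le_const (μ := μ) (f := fun z => W x z * ker μ W n z y) (C := 1)
      (.of_forall fun z => by
        rw [Real.norm_eq_abs, abs_mul]
        have := ih z y
        have h2 : |W x z| ≤ 1 := abs_le.2 ⟨by linarith [(hW x z).1], (hW x z).2⟩
        exact mul_le_one₀ h2 (abs_nonneg _) this)
    simpa [ker] using this

lemma integrable_of_bdd {X : Type*} [MeasurableSpace X] {ν : Measure X} [IsFiniteMeasure ν]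
    {f : X → ℝ} (hf : Measurable f) (hb : ∀ x, |f x| ≤ 1) : Integrable f ν :=
  Integrable.of_bound hf.aestronglyMeasurable 1 (.of_forall hb)

lemma ker_eig {W : Ω → Ω → ℝ} (hWm : Measurable (Function.uncurry W))
    (hW : ∀ x y, W x y ∈ Set.Icc (0 : ℝ) 1) (f : Lp ℝ 2 μ) (l : ℝ)
    (hf : ∀ᵐ x ∂μ, (∫ y, W x y * f y ∂μ) = l * f x) (n : ℕ) :
    ∀ᵐ x ∂μ, (∫ y, ker μ W n x y * f y ∂μ) = l ^ (n + 1) * f x := by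
  induction n with
  | zero => simpa [ker] using hf
  | succ n ih =>
    have hfi : Integrable f μ := (Lp.memLp f).integrable (by norm_num)
    filter_upwards [hf] with x hx
    have hsw : (∫ y, ker μ W (n+1) x y * f y ∂μ)
        = ∫ z, ∫ y, W x z * ker μ W n z y * f y ∂μ ∂μ := by
      simp only [ker]
      simp_rw [← integral_mul_const]
      apply integral_integral_swap
      have : Integrable (fun p : Ω × Ω => f p.1) (μ.prod μ) := hfi.comp_fst μ
      refine this.bdd_mul (c := 1) ?_ (.of_forall fun p => ?_)
      · have a : Measurable (fun q : Ω × Ω => W x q.2) :=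
          hWm.comp (f := fun q : Ω × Ω => (x, q.2)) (by fun_prop)
        have b : Measurable (fun q : Ω × Ω => ker μ W n q.2 q.1) :=
          (ker_meas hWm n).comp (f := fun q : Ω × Ω => (q.2, q.1)) (by fun_prop)
        exact (a.mul b).aestronglyMeasurable
      · rw [Real.norm_eq_abs, abs_mul]
        exact mul_le_one₀ (ker_bound (μ := μ) hW 0 _ _) (abs_nonneg _) (ker_bound hW n _ _)
    rw [hsw]
    have : ∫ z, ∫ y, W x z * ker μ W n z y * f y ∂μ ∂μ
        = ∫ z, l ^ (n+1) * (W x z * f z) ∂μ := by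
      apply integral_congr_ae
      filter_upwards [ih] with z hz
      simp_rw [mul_assoc]
      rw [integral_const_mul, hz]; ring
    rw [this, integral_const_mul, hx]; ring

lemma prod_bound {W : Ω → Ω → ℝ} (hW : ∀ x y, W x y ∈ Set.Icc (0 : ℝ) 1) {n : ℕ}
    (a b : Fin n → Ω) : |∏ i, W (a i) (b i)| ≤ 1 := by
  rw [Finset.abs_prod]
  exact Finset.prod_le_one (fun _ _ => abs_nonneg _)
    (fun i _ => abs_le.2 ⟨by linarith [(hW (a i) (b i)).1], (hW _ _).2⟩)

lemma integral_fin_succ {n : ℕ} (F : (Fin (n + 1) → Ω) → ℝ) (hF : Measurable F)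
    (hb : ∀ x, |F x| ≤ 1) :
    ∫ x, F x ∂(Measure.pi fun _ : Fin (n + 1) => μ)
      = ∫ z, ∫ x, F (Fin.cons z x : Fin (n + 1) → Ω) ∂(Measure.pi fun _ : Fin n => μ) ∂μ := by
  have h := (measurePreserving_piFinSuccAbove (fun _ : Fin (n + 1) => μ) 0).symm
  rw [← h.integral_comp' F, integral_prod]
  · simp only [MeasurableEquiv.piFinSuccAbove_symm_apply, Fin.insertNthEquiv_zero]
    rfl
  · exact integrable_of_bdd (hF.comp (MeasurableEquiv.measurable _)) (fun _ => hb _)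

lemma path_eq {W : Ω → Ω → ℝ} (hWm : Measurable (Function.uncurry W))
    (hW : ∀ x y, W x y ∈ Set.Icc (0 : ℝ) 1) (n : ℕ) (a b : Ω) :
    ∫ x : Fin n → Ω, ∏ i : Fin (n + 1), W ((Fin.cons a x : Fin (n + 1) → Ω) i)
      ((Fin.snoc x b : Fin (n + 1) → Ω) i) ∂(Measure.pi fun _ : Fin n => μ) = ker μ W n a b := by
  induction n generalizing a with
  | zero => simp [ker, Fin.snoc]
  | succ n ih =>
    rw [integral_fin_succ]
    · simp only [ker]
      congr 1
      ext z
      rw [← ih z, ← integral_const_mul]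
      congr 1
      ext x
      rw [Fin.prod_univ_succ, ← Fin.cons_snoc_eq_snoc_cons]
      simp
    · refine Finset.measurable_prod _ fun i _ => ?_
      have h1 : Measurable fun x : Fin (n + 1) → Ω => (Fin.cons a x : Fin (n + 2) → Ω) i := by
        refine Fin.cases ?_ (fun j => ?_) i
        · simp
        · simpa using measurable_pi_apply j
      have h2 : Measurable fun x : Fin (n + 1) → Ω => (Fin.snoc x b : Fin (n + 2) → Ω) i := by
        refine Fin.lastCases ?_ (fun j => ?_) i
        · simp
        · simpa using measurable_pi_apply j
      exact hWm.comp (h1.prodMk h2)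
    · exact fun x => prod_bound hW _ _

lemma cycle_eq {W : Ω → Ω → ℝ} (hWm : Measurable (Function.uncurry W))
    (hW : ∀ x y, W x y ∈ Set.Icc (0 : ℝ) 1) (n : ℕ) :
    (∫ x : Fin (n + 1) → Ω, ∏ i : Fin (n + 1), W (x i) (x (finRotate (n + 1) i))
          ∂(Measure.pi fun _ : Fin (n + 1) => μ)) = ∫ z, ker μ W n z z ∂μ := by
  rw [integral_fin_succ]
  · congr 1
    ext z
    rw [← path_eq hWm hW n z z]
    congr 1
    ext x
    refine Finset.prod_congr rfl fun i _ => ?_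
    congr 1
    refine Fin.lastCases ?_ (fun j => ?_) i
    · simp
    · simp [Fin.coeSucc_eq_succ]
  · refine Finset.measurable_prod _ fun i _ => ?_
    exact hWm.comp (f := fun x : Fin (n + 1) → Ω => (x i, x (finRotate (n + 1) i)))
      ((measurable_pi_apply i).prodMk (measurable_pi_apply _))
  · exact fun x => prod_bound hW _ _

lemma inner_ker {W : Ω → Ω → ℝ} (K : Ω → Ω → ℝ)
    (hK : MemLp (Function.uncurry K) 2 (μ.prod μ)) (f h : Lp ℝ 2 μ) (l : ℝ)
    (hf : ∀ᵐ x ∂μ, (∫ y, K x y * h y ∂μ) = l * h x) :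
    inner ℝ (hK.toLp _) (tens f h) = l * inner ℝ f h := by
  have h1 : inner ℝ (hK.toLp _) (tens f h) = ∫ p : Ω × Ω, K p.1 p.2 * (f p.1 * h p.2) ∂(μ.prod μ) := by
    rw [L2.inner_def]
    apply integral_congr_ae
    filter_upwards [hK.coeFn_toLp, tens_coe f h] with p a b
    simp only [RCLike.inner_apply, conj_trivial, a, b, Function.uncurry]
    ring
  have hint : Integrable (fun p : Ω × Ω => K p.1 p.2 * (f p.1 * h p.2)) (μ.prod μ) :=
    hK.integrable_mul (tens_memLp f h)
  rw [h1, integral_prod _ hint, L2.inner_def, ← integral_const_mul]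
  apply integral_congr_ae
  filter_upwards [hf] with x hx
  have : ∀ y, K x y * (f x * h y) = f x * (K x y * h y) := fun y => by ring
  simp only [this, integral_const_mul, hx, RCLike.inner_apply, conj_trivial]
  ring

end CycleAux

open CycleAux in
/-- if `(e_i)` is an orthonormal Hilbert basis of `L²(Ω, μ)` consisting of
eigenfunctions of the integral operator `T_W` with eigenvalues `λ_i`, then for every
`k ≥ 3` the homomorphism density of the `k`-cycle in `W` equals the `k`-th power sum of
the eigenvalues: `t(C_k, W) = ∫ W(x₁,x₂)⋯W(x_k,x₁) = Σ_i λ_i^k`. In particular cycle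
densities are spectrally invariant. -/
theorem cycle_density_eq_powerSum_of_eigenvalues
    {Ω : Type*} [MeasurableSpace Ω] (μ : Measure Ω) [IsProbabilityMeasure μ]
    (W : Ω → Ω → ℝ)
    (hWmeas : Measurable (Function.uncurry W))
    (hWsymm : ∀ x y, W x y = W y x)
    (hWrange : ∀ x y, W x y ∈ Set.Icc (0 : ℝ) 1)
    {ι : Type*} (e : HilbertBasis ι ℝ (Lp ℝ 2 μ)) (lam : ι → ℝ)
    (heig : ∀ i : ι, ∀ᵐ x ∂μ, (∫ y, W x y * (e i : Lp ℝ 2 μ) y ∂μ) = lam i * (e i : Lp ℝ 2 μ) x) :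
    ∀ k : ℕ, 3 ≤ k →
      (∫ x : Fin k → Ω, ∏ i : Fin k, W (x i) (x (finRotate k i))
          ∂(Measure.pi fun _ : Fin k => μ)) = ∑' i : ι, lam i ^ k := by
  classical
  intro k hk
  obtain ⟨m, rfl⟩ : ∃ m, k = m + 2 := ⟨k - 2, by omega⟩
  rw [cycle_eq hWmeas hWrange (m + 1)]
  have hmem : ∀ n, MemLp (Function.uncurry (ker μ W n)) 2 (μ.prod μ) := fun n =>
    MemLp.of_bound (ker_meas hWmeas n).aestronglyMeasurable 1
      (.of_forall fun p => ker_bound hWrange n p.1 p.2)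
  obtain ⟨b, hb⟩ := tens_basis e
  have hin : ∀ n i j, inner ℝ ((hmem n).toLp _) (b (i, j)) = if i = j then lam i ^ (n + 1) else 0 := by
    intro n i j
    rw [hb, inner_ker (W := W) _ (hmem n) (e i) (e j) _ (ker_eig hWmeas hWrange (e j) (lam j) (heig j) n),
      orthonormal_iff_ite.1 e.orthonormal]
    by_cases h : i = j <;> simp [h]
  have hs := b.hasSum_inner_mul_inner ((hmem 0).toLp _) ((hmem m).toLp _)
  have hval : inner ℝ ((hmem 0).toLp _) ((hmem m).toLp _) = ∫ z, ker μ W (m + 1) z z ∂μ := by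
    have h1 : inner ℝ ((hmem 0).toLp _) ((hmem m).toLp _)
        = ∫ p : Ω × Ω, ker μ W 0 p.1 p.2 * ker μ W m p.1 p.2 ∂(μ.prod μ) := by
      rw [L2.inner_def]
      apply integral_congr_ae
      filter_upwards [(hmem 0).coeFn_toLp, (hmem m).coeFn_toLp] with p a b
      simp only [RCLike.inner_apply, conj_trivial, a, b, Function.uncurry]
      ring
    have hint : Integrable (fun p : Ω × Ω => ker μ W 0 p.1 p.2 * ker μ W m p.1 p.2) (μ.prod μ) :=
      (hmem 0).integrable_mul (hmem m)
    rw [h1, integral_prod_symm _ hint]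
    congr 1
    ext y
    simp only [ker]
    congr 1
    ext x
    rw [hWsymm]
  rw [hval] at hs
  have hinj : Function.Injective (fun i : ι => (i, i)) := fun i j h => (Prod.mk.inj h).1
  rw [← hinj.hasSum_iff] at hs
  · rw [← hs.tsum_eq]
    congr 1
    ext i
    simp only [Function.comp]
    rw [real_inner_comm, real_inner_comm, hin, real_inner_comm, hin]
    simp; ring
  · rintro ⟨i, j⟩ hij
    have : i ≠ j := by
      rintro rfl
      exact hij ⟨i, rfl⟩
    rw [hin, if_neg this, zero_mul]
end
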